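/- Suppose 0 < β < 1/(2N+1), and let Γ_t = ⋃_{j=0}^m (Γ + t_j) be a self-similar set, where t = (t_0, t_1, …, t_m) ∈ ℝ^{m+1} with 0 = t_0 < t_1 < … < t_m. Then either t ∈ T^{m+1} or its conjugate t̂ ∈ T^{m+1}; furthermore, t_{j+1} − t_j > 1 for all 0 ≤ j < m. -/

import Mathlib

noncomputable section

namespace HSCantor

/-- A `D`-coding of `x`: a digit sequence `c` with digits in `D ⊆ ℤ` such that
`x = (1-β)/N · Σ_{k=1}^∞ c_k β^{k-1}` (here indexed from `k = 0`). -/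
def IsCoding (N : ℕ) (β : ℝ) (D : Set ℤ) (x : ℝ) (c : ℕ → ℤ) : Prop :=
  (∀ k, c k ∈ D) ∧ x = (1 - β) / N * ∑' k : ℕ, (c k : ℝ) * β ^ k

/-- The set `Γ_{β,D}` for a digit set `D ⊆ ℤ`. -/
def cantorD (N : ℕ) (β : ℝ) (D : Set ℤ) : Set ℝ := { x | ∃ c, IsCoding N β D x c }

/-- The homogeneous symmetric Cantor set `Γ = Γ_{β,{0,1,…,N}}`. -/
def Gamma (N : ℕ) (β : ℝ) : Set ℝ := cantorD N β (Set.Icc 0 (N : ℤ))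

/-- `E ⊆ ℝ` is a self-similar set: it is nonempty, compact, and is the union of its
images under finitely many contracting similitudes `x ↦ r x + b`, `0 < |r| < 1`. -/
def IsSelfSimilar (E : Set ℝ) : Prop :=
  E.Nonempty ∧ IsCompact E ∧ ∃ F : Finset (ℝ × ℝ),
    (∀ p ∈ F, 0 < |p.1| ∧ |p.1| < 1) ∧
    E = ⋃ p ∈ F, (fun x => p.1 * x + p.2) '' E

/-- `Γ_t = ⋃_{j=0}^m (Γ + t_j)`. -/
def GammaT (N : ℕ) (β : ℝ) {m : ℕ} (t : Fin (m + 1) → ℝ) : Set ℝ :=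
  ⋃ j, (fun x => x + t j) '' Gamma N β

/-- The set `T = ⋃_{n≥1} { (1-β)/N · Σ_{k=1}^n j_k β^{-k} : j_k ∈ {0,…,N} }`. -/
def Tset (N : ℕ) (β : ℝ) : Set ℝ :=
  { x | ∃ n : ℕ, 1 ≤ n ∧ ∃ c : ℕ → ℕ, (∀ k, c k ≤ N) ∧
      x = (1 - β) / N * ∑ k ∈ Finset.Icc 1 n, (c k : ℝ) * β ^ (-(k : ℤ)) }

/-- `d` is a digit representation of the translation vector `t` with `τ` digits:
`t_j = (1-β)/N · Σ_{k=1}^τ d_{j,k} β^{-k}` with all digits in `{0,…,N}`. -/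
def IsDigitRep (N : ℕ) (β : ℝ) {m : ℕ} (t : Fin (m + 1) → ℝ) (τ : ℕ)
    (d : Fin (m + 1) → ℕ → ℕ) : Prop :=
  (∀ j k, d j k ≤ N) ∧
    ∀ j, t j = (1 - β) / N * ∑ k ∈ Finset.Icc 1 τ, (d j k : ℝ) * β ^ (-(k : ℤ))

/-- `d` is a digit representation of `t` with `τ = τ_t` digits, `τ_t` minimal. -/
def IsMinimalRep (N : ℕ) (β : ℝ) {m : ℕ} (t : Fin (m + 1) → ℝ) (τ : ℕ)
    (d : Fin (m + 1) → ℕ → ℕ) : Prop :=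
  IsDigitRep N β t τ d ∧ ∀ τ' < τ, ∀ d', ¬ IsDigitRep N β t τ' d'

/-- `s_k = max_{0 ≤ j ≤ m} t_{j,k}`. -/
def digitSup {m : ℕ} (d : Fin (m + 1) → ℕ → ℕ) (k : ℕ) : ℕ :=
  Finset.univ.sup fun j => d j k

/-- Words of length `n` over the alphabet `{0,1,…,N}`, as lists of naturals. -/
def Words (N n : ℕ) : Set (List ℕ) := { w | w.length = n ∧ ∀ x ∈ w, x ≤ N }

/-- `Ω_t^n`: words `i_1 … i_n ∈ {0,…,N}^n` with `i_{n+1-k} ≤ N - s_k` for `1 ≤ k ≤ τ`.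
(A list `w = [i_1, …, i_n]` satisfies `i_{n+1-k} = w.getD (n-k) 0`.) -/
def Omega (N τ : ℕ) (s : ℕ → ℕ) (n : ℕ) : Set (List ℕ) :=
  { w | w ∈ Words N n ∧ ∀ k, 1 ≤ k → k ≤ τ → w.getD (n - k) 0 + s k ≤ N }

/-- `Ω̂_t^n`: words `i_1 … i_n ∈ {0,…,N}^n` with `i_{n+1-k} ≥ s_k` for `1 ≤ k ≤ τ`. -/
def OmegaHat (N τ : ℕ) (s : ℕ → ℕ) (n : ℕ) : Set (List ℕ) :=
  { w | w ∈ Words N n ∧ ∀ k, 1 ≤ k → k ≤ τ → s k ≤ w.getD (n - k) 0 }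

/-- `W_t^τ = A_t^τ ∪ Â_t^τ`: words obtained from a word in `Ω_t^τ` (resp. `Ω̂_t^τ`)
by adding (resp. subtracting) the digits of some `t_j` to the last `τ` positions. -/
def Wset (N : ℕ) {m : ℕ} (τ : ℕ) (d : Fin (m + 1) → ℕ → ℕ) : Set (List ℕ) :=
  { v | ∃ w ∈ Omega N τ (digitSup d) τ, ∃ j : Fin (m + 1),
      v = List.ofFn fun idx : Fin τ => w.getD idx 0 + d j (τ - (idx : ℕ)) } ∪
  { v | ∃ w ∈ OmegaHat N τ (digitSup d) τ, ∃ j : Fin (m + 1),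
      v = List.ofFn fun idx : Fin τ => w.getD idx 0 - d j (τ - (idx : ℕ)) }

/-- The symbolic admissibility condition:
`⋃_{n=τ}^ℓ {0,…,N}^{n-τ} × W_t^τ × {0,…,N}^{ℓ-n} = {0,…,N}^ℓ` for some `ℓ ≥ τ`. -/
def AdmissibleWith (N : ℕ) {m : ℕ} (τ : ℕ) (d : Fin (m + 1) → ℕ → ℕ) : Prop :=
  ∃ ℓ, τ ≤ ℓ ∧
    (⋃ n ∈ Finset.Icc τ ℓ,
      { z : List ℕ | ∃ u ∈ Words N (n - τ), ∃ w ∈ Wset N τ d, ∃ v ∈ Words N (ℓ - n),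
          z = u ++ w ++ v }) = Words N ℓ

/-- `t` is an admissible translation vector. -/
def IsAdmissible (N : ℕ) (β : ℝ) {m : ℕ} (t : Fin (m + 1) → ℝ) : Prop :=
  (∀ j, t j ∈ Tset N β) ∧
    ∃ τ d, IsMinimalRep N β t τ d ∧ AdmissibleWith N τ d

/-- The vertex set `V_t = {0,…,N}^τ \ W_t^τ` of the directed graph `G_t`. -/
def Vset (N : ℕ) {m : ℕ} (τ : ℕ) (d : Fin (m + 1) → ℕ → ℕ) : Set (List ℕ) :=
  Words N τ \ Wset N τ d

/-- The graph on `V` with an edge `i → j` iff `i_2 … i_τ = j_1 … j_{τ-1}` has a cycle: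
a directed path of positive length starting and ending at the same vertex. -/
def HasCycle (V : Set (List ℕ)) : Prop :=
  ∃ (L : ℕ) (p : ℕ → List ℕ), 0 < L ∧ (∀ i ≤ L, p i ∈ V) ∧
    (∀ i < L, (p i).drop 1 = (p (i + 1)).dropLast) ∧ p 0 = p L

open Classical in
/-- The adjacency matrix of the directed graph `G_t`, indexed by all words of length `τ`
over `{0,…,N}`; its `(i,j)` entry is `1` exactly when `i, j ∈ V_t` and there is a
directed edge `i → j`, and the rows and columns outside `V_t` are zero. -/
def adjMat (N τ : ℕ) (V : Set (List ℕ)) :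
    Matrix (Fin τ → Fin (N + 1)) (Fin τ → Fin (N + 1)) ℕ :=
  fun i j =>
    if (List.ofFn fun k => (i k : ℕ)) ∈ V ∧ (List.ofFn fun k => (j k : ℕ)) ∈ V ∧
        (List.ofFn fun k => (i k : ℕ)).drop 1 = (List.ofFn fun k => (j k : ℕ)).dropLast
    then 1 else 0

/-- `φ_i(x) = βx + i(1-β)/N`. -/
def phi (N : ℕ) (β : ℝ) (i : ℕ) (x : ℝ) : ℝ := β * x + i * (1 - β) / N

/-- `φ_{i_1 … i_n} = φ_{i_1} ∘ ⋯ ∘ φ_{i_n}`. -/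
def phiWord (N : ℕ) (β : ℝ) (w : List ℕ) (x : ℝ) : ℝ := w.foldr (phi N β) x

/-- The conjugate translation vector `t̂_j = t_m - t_{m-j}`. -/
def conj {m : ℕ} (t : Fin (m + 1) → ℝ) : Fin (m + 1) → ℝ :=
  fun j => t (Fin.last m) - t ⟨m - (j : ℕ), Nat.lt_succ_of_le (Nat.sub_le m j)⟩

lemma summable_digits {β : ℝ} (hβ0 : 0 < β) (hβ1 : β < 1) {a : ℕ → ℤ} {C : ℝ}
    (ha : ∀ k, |(a k : ℝ)| ≤ C) : Summable fun k => (a k : ℝ) * β ^ k := by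
  refine Summable.of_norm_bounded
    ((summable_geometric_of_lt_one hβ0.le hβ1).mul_left C) fun k => ?_
  rw [Real.norm_eq_abs, abs_mul, abs_of_pos (pow_pos hβ0 k)]
  exact mul_le_mul_of_nonneg_right (ha k) (pow_pos hβ0 k).le

lemma abs_tsum_digits_le {β : ℝ} (hβ0 : 0 < β) (hβ1 : β < 1) {a : ℕ → ℤ} {C : ℝ}
    (ha : ∀ k, |(a k : ℝ)| ≤ C) : |∑' k, (a k : ℝ) * β ^ k| ≤ C * (1 - β)⁻¹ := by
  have hg := (hasSum_geometric_of_lt_one hβ0.le hβ1).mul_left C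
  rw [← Real.norm_eq_abs]
  refine tsum_of_norm_bounded hg fun k => ?_
  rw [Real.norm_eq_abs, abs_mul, abs_of_pos (pow_pos hβ0 k)]
  exact mul_le_mul_of_nonneg_right (ha k) (pow_pos hβ0 k).le

lemma tsum_digits_succ {β : ℝ} (hβ0 : 0 < β) (hβ1 : β < 1) {a : ℕ → ℤ} {C : ℝ}
    (ha : ∀ k, |(a k : ℝ)| ≤ C) :
    ∑' k, (a k : ℝ) * β ^ k = a 0 + β * ∑' k, (a (k + 1) : ℝ) * β ^ k := by
  rw [(summable_digits hβ0 hβ1 ha).tsum_eq_zero_add, ← tsum_mul_left]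
  simp only [pow_zero, mul_one, pow_succ]
  congr 2
  ext k
  ring

lemma digits_eq_zero {N : ℕ} {β : ℝ} (hβ0 : 0 < β) (hβ1 : β < 1 / (2 * N + 1)) (n : ℕ) :
    ∀ a : ℕ → ℤ, (∀ k, |(a k : ℝ)| ≤ 2 * N) → ∑' k, (a k : ℝ) * β ^ k = 0 → a n = 0 := by
  have hN : (0 : ℝ) ≤ N := N.cast_nonneg
  have hlt : β * (2 * N + 1) < 1 := by rwa [lt_div_iff₀ (by positivity)] at hβ1
  have hβ : β < 1 := by nlinarith
  have head : ∀ a : ℕ → ℤ, (∀ k, |(a k : ℝ)| ≤ 2 * N) → ∑' k, (a k : ℝ) * β ^ k = 0 →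
      a 0 = 0 := by
    intro a ha h0
    rw [tsum_digits_succ hβ0 hβ ha] at h0
    have hb := abs_tsum_digits_le hβ0 hβ fun k => ha (k + 1)
    have h1 : |(a 0 : ℝ)| < 1 := by
      rw [eq_neg_of_add_eq_zero_left h0, abs_neg, abs_mul, abs_of_pos hβ0]
      calc β * _ ≤ β * (2 * N * (1 - β)⁻¹) := mul_le_mul_of_nonneg_left hb hβ0.le
        _ < 1 := by
          rw [← div_eq_mul_inv, ← mul_div_assoc, div_lt_one (by linarith)]
          linarith
    exact Int.abs_lt_one_iff.mp (by exact_mod_cast h1)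
  induction n with
  | zero => exact head
  | succ n ih =>
    intro a ha h0
    refine ih (fun k => a (k + 1)) (fun k => ha (k + 1)) ?_
    have h1 := head a ha h0
    rw [tsum_digits_succ hβ0 hβ ha, h1] at h0
    simpa [hβ0.ne'] using h0

lemma digits_unique {N : ℕ} {β : ℝ} (hβ0 : 0 < β) (hβ1 : β < 1 / (2 * N + 1))
    {a b : ℕ → ℤ} (ha : ∀ k, 0 ≤ a k ∧ a k ≤ 2 * N) (hb : ∀ k, 0 ≤ b k ∧ b k ≤ 2 * N)
    (h : ∑' k, (a k : ℝ) * β ^ k = ∑' k, (b k : ℝ) * β ^ k) : a = b := by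
  have hN : (0 : ℝ) ≤ N := N.cast_nonneg
  have hβ : β < 1 := hβ1.trans_le (by rw [div_le_one (by positivity)]; linarith)
  have bound : ∀ {c : ℤ}, |c| ≤ 2 * N → |(c : ℝ)| ≤ 2 * N := fun hc => by exact_mod_cast hc
  ext n
  refine sub_eq_zero.mp (digits_eq_zero hβ0 hβ1 n (fun k => a k - b k) (fun k => ?_) ?_)
  · exact bound (abs_le.mpr ⟨by linarith [ha k, hb k], by linarith [ha k, hb k]⟩)
  · have sa := summable_digits hβ0 hβ (a := a) (C := 2 * N) fun k =>
      bound (abs_le.mpr ⟨by linarith [ha k], (ha k).2⟩)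
    have sb := summable_digits hβ0 hβ (a := b) (C := 2 * N) fun k =>
      bound (abs_le.mpr ⟨by linarith [hb k], (hb k).2⟩)
    simp only [Int.cast_sub, sub_mul]
    rw [sa.tsum_sub sb, h, sub_self]

section Coding

variable {N : ℕ} {β : ℝ} {x y : ℝ} {c d e : ℕ → ℤ}

lemma IsCoding.summable (hβ0 : 0 < β) (hβ1 : β < 1)
    (hc : IsCoding N β (Set.Icc 0 (N : ℤ)) x c) : Summable fun k => (c k : ℝ) * β ^ k := by
  refine summable_digits hβ0 hβ1 (C := N) fun k => ?_
  have h := hc.1 k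
  rw [abs_of_nonneg (by exact_mod_cast h.1)]
  exact_mod_cast h.2

/-- Codings add digitwise whenever the sum of two coded points is again coded. -/
lemma IsCoding.add_eq (hN : 0 < N) (hβ0 : 0 < β) (hβ1 : β < 1 / (2 * N + 1))
    (hc : IsCoding N β (Set.Icc 0 (N : ℤ)) x c) (hd : IsCoding N β (Set.Icc 0 (N : ℤ)) y d)
    (he : IsCoding N β (Set.Icc 0 (N : ℤ)) (x + y) e) (k : ℕ) : e k = c k + d k := by
  have hN' : (0 : ℝ) < N := by exact_mod_cast hN
  have hβ : β < 1 := hβ1.trans_le (by rw [div_le_one (by positivity)]; linarith)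
  have hδ : (1 - β) / N ≠ 0 := (div_pos (by linarith) hN').ne'
  refine congrFun (digits_unique hβ0 hβ1 (a := e) (b := fun k => c k + d k)
    (fun k => ?_) (fun k => ?_) ?_) k
  · have := he.1 k
    exact ⟨this.1, by linarith [this.1, this.2]⟩
  · have h1 := hc.1 k
    have h2 := hd.1 k
    exact ⟨by linarith [h1.1, h2.1], by linarith [h1.2, h2.2]⟩
  · have h := he.2
    rw [hc.2, hd.2, ← mul_add] at h
    simp only [Int.cast_add, add_mul]
    rw [(hc.summable hβ0 hβ).tsum_add (hd.summable hβ0 hβ)]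
    exact (mul_left_cancel₀ hδ h).symm

/-- Multiplication by `β ^ n` shifts codings. -/
lemma IsCoding.shift (hβ0 : 0 < β) (hβ1 : β < 1)
    (hc : IsCoding N β (Set.Icc 0 (N : ℤ)) x c) (n : ℕ) :
    IsCoding N β (Set.Icc 0 (N : ℤ)) (β ^ n * x) fun k => if k < n then 0 else c (k - n) := by
  refine ⟨fun k => ?_, ?_⟩
  · dsimp only
    split_ifs
    · simp
    · exact hc.1 _
  · have hs : Summable fun k : ℕ => ((if k < n then 0 else c (k - n) : ℤ) : ℝ) * β ^ k := by
      refine (summable_nat_add_iff n).mp ?_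
      simp only [add_lt_iff_neg_right, not_lt_zero, if_false, Nat.add_sub_cancel, pow_add,
        ← mul_assoc]
      exact (hc.summable hβ0 hβ1).mul_right _
    rw [← hs.sum_add_tsum_nat_add n, Finset.sum_eq_zero, zero_add, hc.2]
    · simp only [add_lt_iff_neg_right, not_lt_zero, if_false, Nat.add_sub_cancel, pow_add,
        ← mul_assoc]
      rw [tsum_mul_right]
      ring
    · intro k hk
      simp [Finset.mem_range.mp hk]

lemma isCoding_one (hN : 0 < N) (hβ0 : 0 < β) (hβ1 : β < 1) :
    IsCoding N β (Set.Icc 0 (N : ℤ)) 1 fun _ => (N : ℤ) := by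
  have hN' : (N : ℝ) ≠ 0 := by exact_mod_cast hN.ne'
  have h1 : 1 - β ≠ 0 := by linarith
  refine ⟨fun k => ⟨by positivity, le_rfl⟩, ?_⟩
  rw [tsum_mul_left, tsum_geometric_of_lt_one hβ0.le hβ1]
  push_cast
  field_simp

lemma one_sub_mem_Gamma (hN : 0 < N) (hβ0 : 0 < β) (hβ1 : β < 1) (hx : x ∈ Gamma N β) :
    1 - x ∈ Gamma N β := by
  obtain ⟨c, hc⟩ := hx
  have h1 := isCoding_one hN hβ0 hβ1
  refine ⟨fun k => N - c k, fun k => ?_, ?_⟩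
  · have := hc.1 k
    exact ⟨by linarith [this.2], by linarith [this.1]⟩
  · simp only [Int.cast_sub, sub_mul]
    rw [(h1.summable hβ0 hβ1).tsum_sub (hc.summable hβ0 hβ1), mul_sub, ← h1.2, ← hc.2]

lemma zero_mem_Gamma : (0 : ℝ) ∈ Gamma N β :=
  ⟨fun _ => 0, fun _ => ⟨le_rfl, by positivity⟩, by simp⟩

lemma nonneg_of_mem_Gamma (hβ0 : 0 < β) (hβ1 : β < 1) (hx : x ∈ Gamma N β) : 0 ≤ x := by
  obtain ⟨c, hc⟩ := hx
  rw [hc.2]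
  refine mul_nonneg (div_nonneg (by linarith) N.cast_nonneg) (tsum_nonneg fun k => ?_)
  exact mul_nonneg (by exact_mod_cast (hc.1 k).1) (pow_pos hβ0 k).le

/-- A positive dilation mapping `Γ` into itself has ratio a power of `β`. -/
lemma exists_eq_pow_of_smul_mem (hN : 0 < N) (hβ0 : 0 < β) (hβ1 : β < 1 / (2 * N + 1))
    {ρ : ℝ} (hρ : 0 < ρ) (h : ∀ x ∈ Gamma N β, ρ * x ∈ Gamma N β) : ∃ n : ℕ, ρ = β ^ n := by
  have hN' : (0 : ℝ) < N := by exact_mod_cast hN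
  have hβ : β < 1 := hβ1.trans_le (by rw [div_le_one (by positivity)]; linarith)
  have hδ : (1 - β) / N ≠ 0 := (div_pos (by linarith) hN').ne'
  set δ := (1 - β) / N with hδdef
  have mem1 : ∀ j : ℕ, j ≤ N → ρ * (δ * j) ∈ Gamma N β := by
    intro j hj
    refine h _ ⟨fun k => if k = 0 then j else 0, fun k => ?_, ?_⟩
    · dsimp only
      split_ifs
      · exact ⟨by positivity, by exact_mod_cast hj⟩
      · exact ⟨le_rfl, by positivity⟩
    · rw [tsum_eq_single 0 (by intro k hk; simp [hk])]
      simp [hδdef]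
  have mem2 : ∀ n : ℕ, 0 < n → ρ * (δ * N) + β ^ n * (ρ * δ) ∈ Gamma N β := by
    intro n hn
    have : ρ * (δ * N) + β ^ n * (ρ * δ) = ρ * (δ * (N + β ^ n)) := by ring
    rw [this]
    refine h _ ⟨fun k => if k = 0 then N else if k = n then 1 else 0, fun k => ?_, ?_⟩
    · dsimp only
      split_ifs
      · exact ⟨by positivity, le_rfl⟩
      · exact ⟨by positivity, by exact_mod_cast hN⟩
      · exact ⟨le_rfl, by positivity⟩
    · rw [tsum_eq_sum (s := {0, n}) (by
        intro k hk
        simp only [Finset.mem_insert, Finset.mem_singleton, not_or] at hk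
        simp [hk.1, hk.2]), Finset.sum_pair hn.ne]
      simp [hδdef, hn.ne']
  obtain ⟨c, hc⟩ := mem1 1 hN
  rw [Nat.cast_one, mul_one] at hc
  have hmul : ∀ j : ℕ, j ≤ N →
      IsCoding N β (Set.Icc 0 (N : ℤ)) (ρ * (δ * j)) fun k => j * c k := by
    intro j
    induction j with
    | zero =>
      intro _
      refine ⟨fun k => by simp, by simp⟩
    | succ j ih =>
      intro hj
      obtain ⟨e, he⟩ := mem1 (j + 1) hj
      have h2 : ρ * (δ * ((j + 1 : ℕ) : ℝ)) = ρ * (δ * j) + ρ * δ := by push_cast; ring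
      have h3 := IsCoding.add_eq hN hβ0 hβ1 (ih (by omega)) hc (h2 ▸ he)
      have h4 : e = fun k => ((j + 1 : ℕ) : ℤ) * c k := by
        ext k
        rw [h3 k]
        push_cast
        ring
      exact h4 ▸ he
  have hNc := hmul N le_rfl
  have hle : ∀ k, c k ≤ 1 := by
    intro k
    have h1 : (N : ℤ) * c k ≤ N := (hNc.1 k).2
    have : (0 : ℤ) < N := by exact_mod_cast hN
    nlinarith
  have hsingle : ∀ i k, i < k → c i ≠ 0 → c k = 0 := by
    intro i k hik hi
    obtain ⟨e, he⟩ := mem2 (k - i) (by omega)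
    have h1 := IsCoding.add_eq hN hβ0 hβ1 hNc (hc.shift hβ0 hβ (k - i)) he k
    rw [if_neg (by omega), show k - (k - i) = i by omega] at h1
    have h2 : e k ≤ N := (he.1 k).2
    have h3 : 0 ≤ c i := (hc.1 i).1
    have h4 : 0 ≤ c k := (hc.1 k).1
    have h5 : (0 : ℤ) < N := by exact_mod_cast hN
    have h6 : 0 < c i := lt_of_le_of_ne h3 hi.symm
    by_contra h7
    have h8 : 0 < c k := lt_of_le_of_ne h4 (Ne.symm h7)
    nlinarith
  have hex : ∃ n, c n ≠ 0 := by
    by_contra! hall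
    have h1 := hc.2
    simp only [hall, Int.cast_zero, zero_mul, tsum_zero, mul_zero] at h1
    exact (mul_ne_zero hρ.ne' hδ) h1
  obtain ⟨n, hn⟩ := hex
  refine ⟨n, ?_⟩
  have h1 : c n = 1 := by
    have h3 : 0 ≤ c n := (hc.1 n).1
    have := hle n
    omega
  have h2 := hc.2
  rw [tsum_eq_single n, h1, Int.cast_one, one_mul, mul_comm ρ] at h2
  · exact mul_left_cancel₀ hδ h2
  · intro k hk
    rcases lt_or_gt_of_ne hk with hk | hk
    · have : c k = 0 := by
        by_contra h5
        exact hn (hsingle k n hk h5)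
      simp [this]
    · simp [hsingle n k hk hn]

/-- If both endpoints of a copy `β ^ n • Γ + b` lie in `Γ`, then `b` has only `n` digits. -/
lemma exists_digits_of_add_pow_mem (hN : 0 < N) (hβ0 : 0 < β) (hβ1 : β < 1 / (2 * N + 1))
    {n : ℕ} {b : ℝ} (hb : b ∈ Gamma N β) (hb' : b + β ^ n ∈ Gamma N β) :
    ∃ c : ℕ → ℕ, (∀ k, c k ≤ N) ∧ b = (1 - β) / N * ∑ k ∈ Finset.range n, (c k : ℝ) * β ^ k := by
  have hN' : (0 : ℝ) < N := by exact_mod_cast hN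
  have hβ : β < 1 := hβ1.trans_le (by rw [div_le_one (by positivity)]; linarith)
  obtain ⟨c, hc⟩ := hb
  obtain ⟨e, he⟩ := hb'
  have h1 := (isCoding_one hN hβ0 hβ).shift hβ0 hβ n
  rw [mul_one] at h1
  have hz : ∀ k, n ≤ k → c k = 0 := by
    intro k hk
    have h2 := IsCoding.add_eq hN hβ0 hβ1 hc h1 he k
    rw [if_neg (by omega)] at h2
    have h3 : e k ≤ N := (he.1 k).2
    have h4 : 0 ≤ c k := (hc.1 k).1
    omega
  refine ⟨fun k => (c k).toNat, fun k => ?_, ?_⟩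
  · exact Int.toNat_le.mpr (hc.1 k).2
  · rw [hc.2, tsum_eq_sum (s := Finset.range n)]
    · congr 1
      refine Finset.sum_congr rfl fun k _ => ?_
      congr 1
      have h4 : 0 ≤ c k := (hc.1 k).1
      exact_mod_cast (Int.toNat_of_nonneg h4).symm
    · intro k hk
      rw [hz k (by simpa using hk)]
      simp

end Coding

lemma mem_GammaT {N : ℕ} {β : ℝ} {m : ℕ} {t : Fin (m + 1) → ℝ} {x : ℝ} :
    x ∈ GammaT N β t ↔ ∃ j, ∃ y ∈ Gamma N β, x = y + t j := by
  simp only [GammaT, Set.mem_iUnion, Set.mem_image, eq_comm]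

/-- If `Γ_t` is mapped into itself by a positive contraction fixing `0 = t_0`,
then `t` has a digit representation. -/
lemma exists_isDigitRep {N : ℕ} (hN : 0 < N) {β : ℝ} (hβ0 : 0 < β) (hβ1 : β < 1 / (2 * N + 1))
    {m : ℕ} {t : Fin (m + 1) → ℝ} (ht0 : t 0 = 0) (htpos : ∀ j, j ≠ 0 → 0 < t j)
    {r : ℝ} (hr0 : 0 < r) (hr1 : r < 1) (hr : ∀ x ∈ GammaT N β t, r * x ∈ GammaT N β t) :
    ∃ n d, 1 ≤ n ∧ IsDigitRep N β t n d := by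
  have hN' : (0 : ℝ) < N := by exact_mod_cast hN
  have hβ : β < 1 := hβ1.trans_le (by rw [div_le_one (by positivity)]; linarith)
  have hiter : ∀ n : ℕ, ∀ x ∈ GammaT N β t, r ^ n * x ∈ GammaT N β t := by
    intro n
    induction n with
    | zero => simp
    | succ n ih =>
      intro x hx
      rw [pow_succ, mul_assoc]
      exact ih _ (hr x hx)
  have hsmall : ∀ C : ℝ, ∀ ε > 0, ∀ᶠ n : ℕ in Filter.atTop, r ^ n * C < ε := by
    intro C ε hε
    have h1 := (tendsto_pow_atTop_nhds_zero_of_lt_one hr0.le hr1).mul_const C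
    rw [zero_mul] at h1
    exact h1.eventually (gt_mem_nhds hε)
  have hall : ∀ᶠ n : ℕ in Filter.atTop, ∀ i j, j ≠ 0 → r ^ n * (1 + t i) < t j := by
    refine Filter.eventually_all.mpr fun i => Filter.eventually_all.mpr fun j => ?_
    by_cases hj : j = 0
    · simp [hj]
    · simpa [hj] using hsmall (1 + t i) (t j) (htpos j hj)
  obtain ⟨n, hn, hn1⟩ := (hall.and (hsmall 1 1 one_pos)).exists
  rw [mul_one] at hn1
  set ρ := r ^ n with hρ
  have hρ0 : 0 < ρ := pow_pos hr0 n
  have hcopy : ∀ j, ∀ x ∈ Gamma N β, ρ * (x + t j) ∈ Gamma N β := by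
    intro j x hx
    obtain ⟨i, y, hy, hxy⟩ := mem_GammaT.mp (hiter n _ (mem_GammaT.mpr ⟨j, x, hx, rfl⟩))
    by_cases hi : i = 0
    · rw [hi, ht0, add_zero] at hxy
      rw [hρ, hxy]
      exact hy
    · have h1 := hn j i hi
      have h2 := nonneg_of_mem_Gamma hβ0 hβ hy
      have h3 := nonneg_of_mem_Gamma hβ0 hβ (one_sub_mem_Gamma hN hβ0 hβ hx)
      nlinarith
  obtain ⟨k, hk⟩ := exists_eq_pow_of_smul_mem hN hβ0 hβ1 hρ0
    (fun x hx => by simpa [ht0] using hcopy 0 x hx)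
  have hdig : ∀ j, ∃ c : ℕ → ℕ, (∀ k, c k ≤ N) ∧
      ρ * t j = (1 - β) / N * ∑ i ∈ Finset.range k, (c i : ℝ) * β ^ i := by
    intro j
    refine exists_digits_of_add_pow_mem hN hβ0 hβ1 ?_ (hk ▸ ?_)
    · simpa using hcopy j 0 zero_mem_Gamma
    · have := hcopy j 1 ⟨_, isCoding_one hN hβ0 hβ⟩
      rwa [mul_add, mul_one, add_comm] at this
  choose c hcN hc using hdig
  refine ⟨k, fun j i => c j (k - i), ?_, fun j i => hcN j _, fun j => ?_⟩
  · rw [Nat.one_le_iff_ne_zero]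
    rintro rfl
    rw [hk, pow_zero] at hn1
    exact lt_irrefl _ hn1
  · refine mul_left_cancel₀ hρ0.ne' ?_
    rw [hc j, mul_left_comm]
    congr 1
    rw [Finset.mul_sum, hk]
    refine Finset.sum_bij' (fun i _ => k - i) (fun i _ => k - i) ?_ ?_ ?_ ?_ ?_
    · intro i hi
      simp only [Finset.mem_range, Finset.mem_Icc] at hi ⊢
      omega
    · intro i hi
      simp only [Finset.mem_range, Finset.mem_Icc] at hi ⊢
      omega
    · intro i hi
      simp only [Finset.mem_range] at hi
      omega
    · intro i hi
      simp only [Finset.mem_Icc] at hi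
      omega
    · intro i hi
      simp only [Finset.mem_range] at hi
      dsimp only
      rw [show k - (k - i) = i by omega, mul_left_comm]
      congr 1
      rw [← zpow_natCast, ← zpow_natCast, ← zpow_add₀ hβ0.ne']
      congr 1
      omega

/-- Integer polynomials with coefficients at most `N` in absolute value do not take
values of absolute value in `(0, 1)` at points `x ≥ N + 1`. -/
lemma eq_zero_or_one_le_abs_sum {N : ℕ} {x : ℝ} (hx : N + 1 ≤ x) (n : ℕ) :
    ∀ a : ℕ → ℤ, (∀ k, |a k| ≤ N) →
      ∑ k ∈ Finset.range n, (a k : ℝ) * x ^ k = 0 ∨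
        1 ≤ |∑ k ∈ Finset.range n, (a k : ℝ) * x ^ k| := by
  induction n with
  | zero => simp
  | succ n ih =>
    intro a ha
    have hN : (0 : ℝ) ≤ N := N.cast_nonneg
    have hs : ∑ k ∈ Finset.range (n + 1), (a k : ℝ) * x ^ k =
        x * ∑ k ∈ Finset.range n, (a (k + 1) : ℝ) * x ^ k + a 0 := by
      rw [Finset.sum_range_succ', Finset.mul_sum, pow_zero, mul_one]
      congr 1
      exact Finset.sum_congr rfl fun k _ => by ring
    rw [hs]
    rcases ih (fun k => a (k + 1)) fun k => ha (k + 1) with h | h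
    · rw [h, mul_zero, zero_add]
      by_cases h0 : a 0 = 0
      · exact Or.inl (by exact_mod_cast h0)
      · exact Or.inr (by exact_mod_cast Int.one_le_abs h0)
    · right
      set S := ∑ k ∈ Finset.range n, (a (k + 1) : ℝ) * x ^ k
      have h1 : |(a 0 : ℝ)| ≤ N := by exact_mod_cast ha 0
      have h2 : |x * S| ≤ |x * S + a 0| + |(a 0 : ℝ)| := by
        simpa using abs_sub (x * S + a 0) (a 0 : ℝ)
      rw [abs_mul, abs_of_nonneg (by linarith)] at h2
      nlinarith

/-- Distinct entries of a vector with a digit representation are more than `1` apart. -/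
lemma IsDigitRep.one_lt_sub {N : ℕ} (hN : 0 < N) {β : ℝ} (hβ0 : 0 < β)
    (hβ1 : β < 1 / (2 * N + 1)) {m : ℕ} {t : Fin (m + 1) → ℝ} {n : ℕ}
    {d : Fin (m + 1) → ℕ → ℕ} (h : IsDigitRep N β t n d) {i j : Fin (m + 1)}
    (hij : t i < t j) : 1 < t j - t i := by
  have hN' : (0 : ℝ) < N := by exact_mod_cast hN
  have hlt : β * (2 * N + 1) < 1 := by rwa [lt_div_iff₀ (by positivity)] at hβ1
  have hβ : β < 1 := by nlinarith
  have hx : (N : ℝ) + 1 ≤ β⁻¹ := by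
    rw [le_inv_comm₀ (by positivity) hβ0, ← one_div, le_div_iff₀ (by positivity)]
    nlinarith
  have hδ : 0 < (1 - β) / N := div_pos (by linarith) hN'
  set V := ∑ k ∈ Finset.range n,
    (((d j (1 + k) : ℤ) - (d i (1 + k) : ℤ) : ℤ) : ℝ) * β⁻¹ ^ k with hV
  have hsub : t j - t i = (1 - β) / N * β⁻¹ * V := by
    rw [h.2 i, h.2 j, ← mul_sub, ← Finset.sum_sub_distrib, mul_assoc]
    congr 1
    rw [← Finset.Ico_add_one_right_eq_Icc, Finset.sum_Ico_eq_sum_range, hV, Finset.mul_sum,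
      Nat.add_sub_cancel]
    refine Finset.sum_congr rfl fun k _ => ?_
    rw [zpow_neg, zpow_natCast, pow_add, pow_one, mul_inv, inv_pow]
    push_cast
    ring
  have hδβ : 1 < (1 - β) / N * β⁻¹ := by
    rw [← div_eq_mul_inv, div_div, one_lt_div (by positivity)]
    nlinarith
  have hVpos : 0 < V := by
    rw [← sub_pos, hsub] at hij
    exact pos_of_mul_pos_right hij (by positivity)
  have hV1 : 1 ≤ V := by
    rcases eq_zero_or_one_le_abs_sum hx n
      (fun k => (d j (1 + k) : ℤ) - (d i (1 + k) : ℤ)) (fun k => by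
        have h1 := h.1 i (1 + k)
        have h2 := h.1 j (1 + k)
        rw [abs_le]
        constructor <;> omega) with h0 | h0
    · exact absurd h0 hVpos.ne'
    · rwa [← hV, abs_of_pos hVpos] at h0
  rw [hsub]
  nlinarith

lemma IsDigitRep.mem_Tset {N : ℕ} {β : ℝ} {m : ℕ} {t : Fin (m + 1) → ℝ} {n : ℕ}
    {d : Fin (m + 1) → ℕ → ℕ} (h : IsDigitRep N β t n d) (hn : 1 ≤ n) (j : Fin (m + 1)) :
    t j ∈ Tset N β :=
  ⟨n, hn, d j, h.1 j, h.2 j⟩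

lemma conj_rev {m : ℕ} (t : Fin (m + 1) → ℝ) (j : Fin (m + 1)) :
    conj t j.rev = t (Fin.last m) - t j := by
  unfold conj
  congr 2
  ext
  have := j.2
  simp only [Fin.val_rev]
  omega

/-- `Γ_{t̂}` is the reflection of `Γ_t`. -/
lemma mem_GammaT_conj {N : ℕ} (hN : 0 < N) {β : ℝ} (hβ0 : 0 < β) (hβ1 : β < 1)
    {m : ℕ} {t : Fin (m + 1) → ℝ} {x : ℝ} :
    x ∈ GammaT N β (conj t) ↔ 1 + t (Fin.last m) - x ∈ GammaT N β t := by
  simp only [mem_GammaT]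
  constructor
  · rintro ⟨j, y, hy, rfl⟩
    refine ⟨j.rev, 1 - y, one_sub_mem_Gamma hN hβ0 hβ1 hy, ?_⟩
    have := conj_rev t j.rev
    rw [Fin.rev_rev] at this
    rw [this]
    ring
  · rintro ⟨j, y, hy, hxy⟩
    refine ⟨j.rev, 1 - y, one_sub_mem_Gamma hN hβ0 hβ1 hy, ?_⟩
    rw [conj_rev]
    linarith

/-- Suppose `0 < β < 1/(2N+1)` and `Γ_t = ⋃_{j=0}^m (Γ + t_j)` is a self-similar set,
where `0 = t_0 < ⋯ < t_m`. Then either `t ∈ T^{m+1}` or `t̂ ∈ T^{m+1}`; furthermore,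
`t_{j+1} - t_j > 1` for all `0 ≤ j < m`. -/
theorem stmt10 (N : ℕ) (hN : 0 < N) (β : ℝ) (hβ0 : 0 < β) (hβ1 : β < 1 / (2 * N + 1))
    (m : ℕ) (t : Fin (m + 1) → ℝ) (ht0 : t 0 = 0) (hmono : StrictMono t)
    (hss : IsSelfSimilar (GammaT N β t)) :
    ((∀ j, t j ∈ Tset N β) ∨ (∀ j, conj t j ∈ Tset N β)) ∧
      ∀ j : Fin m, 1 < t j.succ - t j.castSucc := by
  have hN' : (0 : ℝ) < N := by exact_mod_cast hN
  have hβ : β < 1 := hβ1.trans_le (by rw [div_le_one (by positivity)]; linarith)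
  obtain ⟨-, -, F, hF, hE⟩ := hss
  set M := 1 + t (Fin.last m) with hM
  have hbd : ∀ x ∈ GammaT N β t, 0 ≤ x ∧ x ≤ M := by
    intro x hx
    obtain ⟨j, y, hy, rfl⟩ := mem_GammaT.mp hx
    have h1 := nonneg_of_mem_Gamma hβ0 hβ hy
    have h2 := nonneg_of_mem_Gamma hβ0 hβ (one_sub_mem_Gamma hN hβ0 hβ hy)
    have h3 := hmono.monotone (Fin.zero_le j)
    have h4 := hmono.monotone (Fin.le_last j)
    exact ⟨by linarith, by linarith⟩
  have h0E : (0 : ℝ) ∈ GammaT N β t := mem_GammaT.mpr ⟨0, 0, zero_mem_Gamma, by simp [ht0]⟩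
  have hME : M ∈ GammaT N β t :=
    mem_GammaT.mpr ⟨Fin.last m, 1, ⟨_, isCoding_one hN hβ0 hβ⟩, rfl⟩
  have hmap : ∀ p ∈ F, ∀ x ∈ GammaT N β t, p.1 * x + p.2 ∈ GammaT N β t := by
    intro p hp x hx
    rw [hE]
    exact Set.mem_iUnion₂.mpr ⟨p, hp, x, hx, rfl⟩
  have hpre : ∀ y ∈ GammaT N β t, ∃ p ∈ F, ∃ x ∈ GammaT N β t, p.1 * x + p.2 = y := by
    intro y hy
    rw [hE] at hy
    obtain ⟨p, hp, x, hx, hxy⟩ := Set.mem_iUnion₂.mp hy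
    exact ⟨p, hp, x, hx, hxy⟩
  have hstable : (∃ r, 0 < r ∧ r < 1 ∧ ∀ x ∈ GammaT N β t, r * x ∈ GammaT N β t) ∨
      ∃ r, 0 < r ∧ r < 1 ∧ ∀ x ∈ GammaT N β (conj t), r * x ∈ GammaT N β (conj t) := by
    obtain ⟨⟨r, b⟩, hp, x, hx, hxy⟩ := hpre 0 h0E
    obtain ⟨⟨s, a⟩, hq, z, hz, hzw⟩ := hpre M hME
    obtain ⟨hr0, hr1⟩ := hF _ hp
    obtain ⟨hs0, hs1⟩ := hF _ hq
    have mr := hmap _ hp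
    have ms := hmap _ hq
    dsimp only at *
    rw [abs_pos] at hr0 hs0
    rw [abs_lt] at hr1 hs1
    have bx := hbd x hx
    have bz := hbd z hz
    have r0 := hbd _ (mr 0 h0E)
    have rM := hbd _ (mr M hME)
    have s0 := hbd _ (ms 0 h0E)
    have sM := hbd _ (ms M hME)
    rcases lt_or_gt_of_ne hr0 with hr | hr
    · have hb : b = -(r * M) := by nlinarith
      rcases lt_or_gt_of_ne hs0 with hs | hs
      · left
        have ha : a = M := by nlinarith
        refine ⟨r * s, mul_pos_of_neg_of_neg hr hs, by nlinarith, fun w hw => ?_⟩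
        have := mr _ (ms w hw)
        rw [hb, ha] at this
        convert this using 1
        ring
      · right
        have ha : a = M - s * M := by nlinarith
        refine ⟨s, hs, hs1.2, fun w hw => ?_⟩
        rw [mem_GammaT_conj hN hβ0 hβ, ← hM] at hw ⊢
        have := ms _ hw
        rw [ha] at this
        convert this using 1
        ring
    · left
      have hb : b = 0 := by nlinarith
      exact ⟨r, hr, hr1.2, fun w hw => by simpa [hb] using mr w hw⟩
  rcases hstable with ⟨r, hr0, hr1, hr⟩ | ⟨r, hr0, hr1, hr⟩
  · obtain ⟨n, d, hn, hd⟩ := exists_isDigitRep hN hβ0 hβ1 ht0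
      (fun j hj => ht0 ▸ hmono (Fin.pos_of_ne_zero hj)) hr0 hr1 hr
    exact ⟨Or.inl fun j => hd.mem_Tset hn j, fun j =>
      hd.one_lt_sub hN hβ0 hβ1 (hmono j.castSucc_lt_succ)⟩
  · have hconj : ∀ j, conj t j = t (Fin.last m) - t j.rev := fun j => by
      rw [← conj_rev, Fin.rev_rev]
    obtain ⟨n, d, hn, hd⟩ := exists_isDigitRep (t := conj t) hN hβ0 hβ1 (by simp [hconj])
      (fun j hj => by
        rw [hconj, sub_pos]
        refine hmono (lt_of_le_of_ne (Fin.le_last _) fun h => hj ?_)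
        rw [← Fin.rev_rev j, h, Fin.rev_last]) hr0 hr1 hr
    refine ⟨Or.inr fun j => hd.mem_Tset hn j, fun j => ?_⟩
    have hlt := hmono j.castSucc_lt_succ
    have := hd.one_lt_sub hN hβ0 hβ1 (i := j.succ.rev) (j := j.castSucc.rev)
      (by rw [conj_rev, conj_rev]; linarith)
    rw [conj_rev, conj_rev] at this
    linarith


end HSCantor
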